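/- Let k > 0 and let l ≥ 0 be an integer. There exists a constant C > 0, depending only on k and l, such that for every t ≥ 0 and every measurable function g : ℝ → ℂⁿ, ∫_{−1}^{1} ξ^{2l} |g(ξ)|² exp(−2k ξ² t/(1 + ξ²)) dξ ≤ C (1 + t)^{−(l + 1/2)} (sup_{ξ ∈ ℝ} |g(ξ)|)², whenever sup_{ξ ∈ ℝ} |g(ξ)| is finite. -/

import Mathlib

/-- Polynomial moments of a Gaussian are finite. -/
theorem integrable_pow_mul_exp_neg_mul_sq {k : ℝ} (hk : 0 < k) (m : ℕ) :
    MeasureTheory.Integrable (fun x : ℝ => x ^ m * Real.exp (-k * x ^ 2)) := by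
  have hm : (-1 : ℝ) < (m : ℝ) := by
    have : (0 : ℝ) ≤ m := m.cast_nonneg
    linarith
  simpa only [Real.rpow_natCast] using integrable_rpow_mul_exp_neg_mul_sq hk hm

/-- Scaling of the even moments of a Gaussian. -/
theorem integral_pow_mul_exp_neg_mul_sq_scale (k : ℝ) (l : ℕ) {a : ℝ} (ha : 0 < a) :
    ∫ x : ℝ, x ^ (2 * l) * Real.exp (-(k * a) * x ^ 2) =
      a ^ (-((l : ℝ) + 1 / 2)) * ∫ x : ℝ, x ^ (2 * l) * Real.exp (-k * x ^ 2) := by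
  have hs : 0 < Real.sqrt a := Real.sqrt_pos.2 ha
  have hsq : Real.sqrt a ^ 2 = a := Real.sq_sqrt ha.le
  have key := MeasureTheory.Measure.integral_comp_mul_left
    (fun x : ℝ => x ^ (2 * l) * Real.exp (-k * x ^ 2)) (Real.sqrt a)
  have hfun : (fun x : ℝ => (Real.sqrt a * x) ^ (2 * l) * Real.exp (-k * (Real.sqrt a * x) ^ 2)) =
      fun x => a ^ l * (x ^ (2 * l) * Real.exp (-(k * a) * x ^ 2)) := by
    funext x
    rw [mul_pow, mul_pow, pow_mul, hsq]
    ring_nf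
  rw [hfun, MeasureTheory.integral_const_mul, abs_of_pos (inv_pos.2 hs), smul_eq_mul] at key
  have hal : (0 : ℝ) < a ^ l := pow_pos ha l
  have hpow : a ^ (-((l : ℝ) + 1 / 2)) = (a ^ l)⁻¹ * (Real.sqrt a)⁻¹ := by
    rw [Real.rpow_neg ha.le, Real.rpow_add ha, Real.rpow_natCast, ← Real.sqrt_eq_rpow, mul_inv]
  rw [hpow, mul_assoc, ← key, inv_mul_cancel_left₀ hal.ne']

/-- On `[-1, 1]` the symbol decays at least like a Gaussian. -/
theorem exp_neg_symbol_le {k t x : ℝ} (hk : 0 ≤ k) (ht : 0 ≤ t) (hx : x ^ 2 ≤ 1) :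
    Real.exp (-(2 * k * x ^ 2 * t / (1 + x ^ 2))) ≤
      Real.exp k * Real.exp (-(k * (1 + t)) * x ^ 2) := by
  rw [← Real.exp_add, Real.exp_le_exp]
  have hA : 0 ≤ k * x ^ 2 * t := by positivity
  have h : k * x ^ 2 * t ≤ 2 * k * x ^ 2 * t / (1 + x ^ 2) := by
    rw [le_div_iff₀ (by positivity)]
    nlinarith
  nlinarith

/-- Low-frequency estimate: for bounded measurable `g : ℝ → ℂⁿ`,
`∫_{−1}^{1} ξ^{2l} |g(ξ)|² exp(−2kξ²t/(1+ξ²)) dξ ≤ C (1+t)^{−(l+1/2)} (sup|g|)²`,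
with `C` depending only on `k` and `l`. -/
theorem low_frequency_decay_estimate (n : ℕ) (hn : 1 ≤ n) (k : ℝ) (hk : 0 < k)
    (l : ℕ) :
    ∃ C : ℝ, 0 < C ∧
      ∀ t : ℝ, 0 ≤ t → ∀ g : ℝ → EuclideanSpace ℂ (Fin n), MeasureTheory.AEStronglyMeasurable g MeasureTheory.volume →
        ∀ M : ℝ, (∀ ξ : ℝ, ‖g ξ‖ ≤ M) →
          (∫ ξ in (-1 : ℝ)..1,
              ξ ^ (2 * l) * ‖g ξ‖ ^ 2 * Real.exp (-(2 * k * ξ ^ 2 * t / (1 + ξ ^ 2))))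
            ≤ C * (1 + t) ^ (-((l : ℝ) + 1 / 2)) * M ^ 2 := by
  have hpow (x : ℝ) : 0 ≤ x ^ (2 * l) := (even_two_mul l).pow_nonneg x
  set J : ℝ := ∫ x : ℝ, x ^ (2 * l) * Real.exp (-k * x ^ 2) with hJ
  have hJ0 : 0 ≤ J := MeasureTheory.integral_nonneg fun x => mul_nonneg (hpow x) (Real.exp_pos _).le
  refine ⟨Real.exp k * (J + 1), by positivity, fun t ht g _ M hM => ?_⟩
  have ht1 : 0 < 1 + t := by linarith
  set F : ℝ → ℝ := fun x =>
    (M ^ 2 * Real.exp k) * (x ^ (2 * l) * Real.exp (-(k * (1 + t)) * x ^ 2)) with hF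
  have hFint : MeasureTheory.Integrable F :=
    (integrable_pow_mul_exp_neg_mul_sq (mul_pos hk ht1) (2 * l)).const_mul _
  have hF0 (x : ℝ) : 0 ≤ F x :=
    mul_nonneg (by positivity) (mul_nonneg (hpow x) (Real.exp_pos _).le)
  rw [intervalIntegral.integral_of_le (by norm_num)]
  calc _ ≤ ∫ x in Set.Ioc (-1 : ℝ) 1, F x := by
        refine MeasureTheory.integral_mono_of_nonneg
          (Filter.Eventually.of_forall fun x =>
            mul_nonneg (mul_nonneg (hpow x) (sq_nonneg _)) (Real.exp_pos _).le)
          hFint.integrableOn ?_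
        filter_upwards [MeasureTheory.ae_restrict_mem measurableSet_Ioc] with x hx
        have hx2 : x ^ 2 ≤ 1 := by nlinarith [hx.1, hx.2]
        have hg : ‖g x‖ ^ 2 ≤ M ^ 2 := pow_le_pow_left₀ (norm_nonneg _) (hM x) 2
        calc _ ≤ x ^ (2 * l) * M ^ 2 * (Real.exp k * Real.exp (-(k * (1 + t)) * x ^ 2)) :=
              mul_le_mul (mul_le_mul_of_nonneg_left hg (hpow x)) (exp_neg_symbol_le hk.le ht hx2)
                (Real.exp_pos _).le (mul_nonneg (hpow x) (sq_nonneg _))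
          _ = F x := by simp only [hF]; ring
    _ ≤ ∫ x, F x := MeasureTheory.setIntegral_le_integral hFint (Filter.Eventually.of_forall hF0)
    _ = Real.exp k * J * (1 + t) ^ (-((l : ℝ) + 1 / 2)) * M ^ 2 := by
        rw [hF, MeasureTheory.integral_const_mul, integral_pow_mul_exp_neg_mul_sq_scale k l ht1]
        ring
    _ ≤ _ := by
        gcongr
        linarith
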